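/- Semi-discrete L² decay with upwind fluxes (lowest-order case): let N ≥ 1, h > 0, a ∈ ℝ, define the upwind numerical flux G(u,v) = (a/2)(u+v) − (|a|/2)(v−u), and let f : ℝ → (ZMod N → ℝ) be such that each component t ↦ f(t)_j is differentiable and satisfies d/dt f(t)_j = −(1/h)(G(f(t)_j, f(t)_{j+1}) − G(f(t)_{j−1}, f(t)_j)) for all t and all j ∈ ZMod N (periodic grid). Then d/dt Σ_{j ∈ ZMod N} (f(t)_j)² = −(|a|/h) Σ_{j ∈ ZMod N} (f(t)_{j+1} − f(t)_j)² ≤ 0; in particular the discrete L² norm Σ_j (f(t)_j)² is a nonincreasing function of t. -/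

import Mathlib

open scoped BigOperators

/-- A sum of backward differences over a periodic grid vanishes. -/
lemma sum_sub_shift_eq_zero {ι M : Type*} [Fintype ι] [AddGroup ι] [AddCommGroup M]
    (P : ι → M) (c : ι) : ∑ j, (P j - P (j - c)) = 0 := by
  rw [Finset.sum_sub_distrib, sub_eq_zero]
  exact ((Equiv.subRight c).sum_comp P).symm

/-- Semi-discrete L² decay with upwind fluxes (lowest order): on a periodic
grid of `N ≥ 1` cells, with upwind flux `G(u,v) = (a/2)(u+v) - (|a|/2)(v-u)` and scheme
`d/dt f_j = -(1/h)(G(f_j, f_{j+1}) - G(f_{j-1}, f_j))`, the discrete L² norm satisfies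
`d/dt ∑ j f_j² = -(|a|/h) ∑ j (f_{j+1} - f_j)² ≤ 0`, and hence is nonincreasing. -/
theorem stmt_16 (N : ℕ) [NeZero N] (h : ℝ) (hh : 0 < h) (a : ℝ)
    (G : ℝ → ℝ → ℝ)
    (hG : ∀ u v, G u v = (a / 2) * (u + v) - (|a| / 2) * (v - u))
    (f : ℝ → ZMod N → ℝ)
    (hf : ∀ t (j : ZMod N),
      HasDerivAt (fun s => f s j)
        (-(1 / h) * (G (f t j) (f t (j + 1)) - G (f t (j - 1)) (f t j))) t) :
    (∀ t : ℝ,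
      HasDerivAt (fun s => ∑ j : ZMod N, (f s j) ^ 2)
        (-(|a| / h) * ∑ j : ZMod N, (f t (j + 1) - f t j) ^ 2) t ∧
      -(|a| / h) * (∑ j : ZMod N, (f t (j + 1) - f t j) ^ 2) ≤ 0) ∧
      ∀ t₁ t₂ : ℝ, t₁ ≤ t₂ →
        (∑ j : ZMod N, (f t₂ j) ^ 2) ≤ ∑ j : ZMod N, (f t₁ j) ^ 2 := by
  have hderiv (t : ℝ) : HasDerivAt (fun s => ∑ j : ZMod N, (f s j) ^ 2)
      (-(|a| / h) * ∑ j : ZMod N, (f t (j + 1) - f t j) ^ 2) t := by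
    refine (HasDerivAt.fun_sum fun j _ => (hf t j).fun_pow 2).congr_deriv ?_
    rw [← sub_eq_zero, Finset.mul_sum, ← Finset.sum_sub_distrib]
    refine Eq.trans (Finset.sum_congr rfl fun j _ => ?_)
      (sum_sub_shift_eq_zero (fun j : ZMod N => -(a / h) * (f t j * f t (j + 1)) +
        |a| / h * (f t (j + 1) ^ 2 - f t j * f t (j + 1))) 1)
    simp only [hG, sub_add_cancel]
    push_cast
    ring
  have hnonpos (t : ℝ) :
      -(|a| / h) * (∑ j : ZMod N, (f t (j + 1) - f t j) ^ 2) ≤ 0 :=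
    mul_nonpos_of_nonpos_of_nonneg (neg_nonpos.mpr (by positivity))
      (Finset.sum_nonneg fun _ _ => sq_nonneg _)
  exact ⟨fun t => ⟨hderiv t, hnonpos t⟩,
    fun _ _ ht => antitone_of_hasDerivAt_nonpos hderiv hnonpos ht⟩
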